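/- arXiv:2208.00518 — 8 statements merged into one kernel-verified Lean document; each statement's English description precedes it below -/
import Mathlib

section
/- Let (Ω,ℱ,ℙ) be a probability space, m ≥ 2 an integer, 𝒢₁,…,𝒢ₘ sub-σ-algebras of ℱ, and α ≥ 0 a constant such that for every 1 ≤ k ≤ m−1, every event E measurable with respect to the σ-algebra generated by 𝒢₁ ∪ … ∪ 𝒢ₖ, and every event F ∈ 𝒢ₖ₊₁, one has ℙ(E∩F) ≤ ℙ(E)ℙ(F) + α. If A₁,…,Aₘ are events with Aᵢ ∈ 𝒢ᵢ and ℙ(Aᵢ) = p for all i, then ℙ(⋂_{i=1}^{m} Aᵢ) ≤ pᵐ + α·∑_{j=0}^{m−2} pʲ; in particular, if p < 1 then ℙ(⋂_{i=1}^{m} Aᵢ) ≤ pᵐ + α/(1−p). -/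
open MeasureTheory
open scoped ENNReal

theorem ENNReal.sum_range_pow_le_inv_one_sub (p : ℝ≥0∞) (n : ℕ) :
    ∑ j ∈ Finset.range n, p ^ j ≤ (1 - p)⁻¹ :=
  (ENNReal.sum_le_tsum _).trans_eq (ENNReal.tsum_geometric p)

theorem le_pow_add_mul_geom_sum {m : ℕ} {u : ℕ → ℝ≥0∞} {p α : ℝ≥0∞} (h0 : u 0 ≤ p)
    (hstep : ∀ k, k + 1 < m → u (k + 1) ≤ u k * p + α) (k : ℕ) (hk : k < m) :
    u k ≤ p ^ (k + 1) + α * ∑ j ∈ Finset.range k, p ^ j := by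
  induction k with
  | zero => simpa using h0
  | succ k ih =>
    calc u (k + 1) ≤ u k * p + α := hstep k hk
      _ ≤ (p ^ (k + 1) + α * ∑ j ∈ Finset.range k, p ^ j) * p + α := by
        gcongr
        exact ih (by lia)
      _ = p ^ (k + 1 + 1) + α * ∑ j ∈ Finset.range (k + 1), p ^ j := by
        rw [geom_sum_succ]
        ring

theorem measurableSet_iSup_biInter_le {Ω : Type*} {m : ℕ} {𝒢 : Fin m → MeasurableSpace Ω}
    {A : Fin m → Set Ω} (hA : ∀ i, MeasurableSet[𝒢 i] (A i)) (k : ℕ) :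
    MeasurableSet[⨆ (i : Fin m) (_ : (i : ℕ) ≤ k), 𝒢 i] (⋂ (i : Fin m) (_ : (i : ℕ) ≤ k), A i) :=
  MeasurableSet.iInter fun i => MeasurableSet.iInter fun hi =>
    le_iSup₂_of_le (f := fun (i : Fin m) (_ : (i : ℕ) ≤ k) => 𝒢 i) i hi le_rfl _ (hA i)

theorem biInter_le_succ {Ω : Type*} {m : ℕ} (A : Fin m → Set Ω) (k : ℕ) (hk : k + 1 < m) :
    ⋂ (i : Fin m) (_ : (i : ℕ) ≤ k + 1), A i =
      (⋂ (i : Fin m) (_ : (i : ℕ) ≤ k), A i) ∩ A ⟨k + 1, hk⟩ := by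
  ext x
  simp only [Set.mem_iInter, Set.mem_inter_iff]
  refine ⟨fun h => ⟨fun i hi => h i (by lia), h _ le_rfl⟩, fun ⟨h, h'⟩ i hi => ?_⟩
  rcases Nat.le_succ_iff.1 hi with hi | hi
  · exact h i hi
  · rwa [show i = ⟨k + 1, hk⟩ from Fin.ext hi]

/-- iterated upper α-mixing bound for intersections of equal-probability
events measurable with respect to successive σ-algebras. -/
theorem stmt_1 {Ω : Type*} [mΩ : MeasurableSpace Ω] (ℙ : Measure Ω) [IsProbabilityMeasure ℙ]
    (m : ℕ) (hm : 2 ≤ m)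
    (𝒢 : Fin m → MeasurableSpace Ω) (h𝒢 : ∀ i, 𝒢 i ≤ mΩ)
    (α : ℝ≥0∞)
    (hmix : ∀ (k : ℕ) (hk : k + 1 < m) (E F : Set Ω),
      MeasurableSet[⨆ (i : Fin m) (_ : (i : ℕ) ≤ k), 𝒢 i] E →
      MeasurableSet[𝒢 ⟨k + 1, hk⟩] F →
      ℙ (E ∩ F) ≤ ℙ E * ℙ F + α)
    (A : Fin m → Set Ω) (hA : ∀ i, MeasurableSet[𝒢 i] (A i))
    (p : ℝ≥0∞) (hp : ∀ i, ℙ (A i) = p) :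
    ℙ (⋂ i, A i) ≤ p ^ m + α * ∑ j ∈ Finset.range (m - 1), p ^ j ∧
      (p < 1 → ℙ (⋂ i, A i) ≤ p ^ m + α / (1 - p)) := by
  have hbound := le_pow_add_mul_geom_sum (m := m) (p := p) (α := α)
    (u := fun k => ℙ (⋂ (i : Fin m) (_ : (i : ℕ) ≤ k), A i))
    (by
      rw [← hp ⟨0, by lia⟩]
      exact measure_mono (Set.iInter₂_subset (⟨0, by lia⟩ : Fin m) (Nat.zero_le 0)))
    (fun k hk => by
      rw [biInter_le_succ A k hk]
      simpa only [hp] using hmix k hk _ _ (measurableSet_iSup_biInter_le hA k) (hA _))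
    (m - 1) (by lia)
  have hInter : ⋂ (i : Fin m) (_ : (i : ℕ) ≤ m - 1), A i = ⋂ i, A i :=
    Set.iInter_congr fun i => iInf_pos (by lia)
  rw [hInter, Nat.sub_add_cancel (by lia)] at hbound
  refine ⟨hbound, fun _ => hbound.trans ?_⟩
  rw [div_eq_mul_inv]
  gcongr
  exact ENNReal.sum_range_pow_le_inv_one_sub p _
end

section
/- Let (Ω,ℱ,ℙ) be a probability space, m ≥ 2 an integer, 𝒢₁,…,𝒢ₘ sub-σ-algebras of ℱ, and φ ≥ 0 a constant such that for every 1 ≤ k ≤ m−1, every event E measurable with respect to the σ-algebra generated by 𝒢₁ ∪ … ∪ 𝒢ₖ, and every event F ∈ 𝒢ₖ₊₁, one has ℙ(E∩F) ≤ ℙ(E)(ℙ(F) + φ). If A₁,…,Aₘ are events with Aᵢ ∈ 𝒢ᵢ and ℙ(Aᵢ) = p for all i, then ℙ(⋂_{i=1}^{m} Aᵢ) ≤ (p+φ)^{m−1}. -/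
open MeasureTheory
open scoped ENNReal

/-- iterated upper φ-mixing bound for intersections of equal-probability
events measurable with respect to successive σ-algebras. -/
theorem stmt_2 {Ω : Type*} [mΩ : MeasurableSpace Ω] (ℙ : Measure Ω) [IsProbabilityMeasure ℙ]
    (m : ℕ) (hm : 2 ≤ m)
    (𝒢 : Fin m → MeasurableSpace Ω) (h𝒢 : ∀ i, 𝒢 i ≤ mΩ)
    (φ : ℝ≥0∞)
    (hmix : ∀ (k : ℕ) (hk : k + 1 < m) (E F : Set Ω),
      MeasurableSet[⨆ (i : Fin m) (_ : (i : ℕ) ≤ k), 𝒢 i] E →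
      MeasurableSet[𝒢 ⟨k + 1, hk⟩] F →
      ℙ (E ∩ F) ≤ ℙ E * (ℙ F + φ))
    (A : Fin m → Set Ω) (hA : ∀ i, MeasurableSet[𝒢 i] (A i))
    (p : ℝ≥0∞) (hp : ∀ i, ℙ (A i) = p) :
    ℙ (⋂ i, A i) ≤ (p + φ) ^ (m - 1) := by
  have key : ∀ k, k < m → ℙ (⋂ (i : Fin m) (_ : (i : ℕ) ≤ k), A i) ≤ (p + φ) ^ k := by
    intro k
    induction k with
    | zero => intro _; simpa using prob_le_one
    | succ k ih =>
      intro hk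
      have hE : MeasurableSet[⨆ (i : Fin m) (_ : (i : ℕ) ≤ k), 𝒢 i]
          (⋂ (i : Fin m) (_ : (i : ℕ) ≤ k), A i) :=
        MeasurableSet.iInter fun i => MeasurableSet.iInter fun hi =>
          le_iSup₂ (f := fun (i : Fin m) (_ : (i : ℕ) ≤ k) => 𝒢 i) i hi _ (hA i)
      calc ℙ (⋂ (i : Fin m) (_ : (i : ℕ) ≤ k + 1), A i)
          ≤ ℙ ((⋂ (i : Fin m) (_ : (i : ℕ) ≤ k), A i) ∩ A ⟨k + 1, hk⟩) := by
            refine measure_mono fun x hx => ?_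
            simp only [Set.mem_inter_iff, Set.mem_iInter] at hx ⊢
            exact ⟨fun i hi => hx i (by omega), hx _ le_rfl⟩
        _ ≤ ℙ (⋂ (i : Fin m) (_ : (i : ℕ) ≤ k), A i) * (ℙ (A ⟨k + 1, hk⟩) + φ) :=
            hmix k hk _ _ hE (hA _)
        _ ≤ (p + φ) ^ k * (p + φ) := by
            rw [hp]
            gcongr
            exact ih (by omega)
        _ = (p + φ) ^ (k + 1) := (pow_succ _ _).symm
  refine (measure_mono ?_).trans (key (m - 1) (by omega))
  exact Set.subset_iInter₂ fun i _ => Set.iInter_subset A i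
end

section
/- Let (Ω,ℱ,ℙ) be a probability space, d ≥ 2 an integer, 𝒢₁,…,𝒢_d sub-σ-algebras of ℱ, and ψ ≥ 0 a constant such that for every 1 ≤ k ≤ d−1, every event E measurable with respect to the σ-algebra generated by 𝒢₁ ∪ … ∪ 𝒢ₖ, and every event F ∈ 𝒢ₖ₊₁, one has ℙ(E∩F) ≤ (1+ψ)ℙ(E)ℙ(F). Then for any nonnegative bounded random variables Y₁,…,Y_d with Yᵢ measurable with respect to 𝒢ᵢ, one has E[∏_{i=1}^{d} Yᵢ] ≤ (1+ψ)^{d−1}·∏_{i=1}^{d} E[Yᵢ]. -/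
open MeasureTheory
open scoped ENNReal

/-- If events of two sub-σ-algebras satisfy `μ (E ∩ F) ≤ c * (μ E * μ F)`, then so do nonnegative
functions measurable with respect to them. -/
theorem lintegral_mul_le_of_measure_inter_le {Ω : Type*} {m₁ m₂ mΩ : MeasurableSpace Ω}
    (h₁ : m₁ ≤ mΩ) (h₂ : m₂ ≤ mΩ) {μ : Measure Ω} {c : ℝ≥0∞}
    (hμ : ∀ E F, MeasurableSet[m₁] E → MeasurableSet[m₂] F → μ (E ∩ F) ≤ c * (μ E * μ F))
    {f g : Ω → ℝ≥0∞} (hf : Measurable[m₁] f) (hg : Measurable[m₂] g) :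
    ∫⁻ ω, f ω * g ω ∂μ ≤ c * ((∫⁻ ω, f ω ∂μ) * ∫⁻ ω, g ω ∂μ) := by
  have hset : ∀ F, MeasurableSet[m₂] F → ∫⁻ ω in F, f ω ∂μ ≤ c * (∫⁻ ω, f ω ∂μ) * μ F := by
    intro F hF
    have hle : (μ.restrict F).trim h₁ ≤ (c * μ F) • μ.trim h₁ := by
      refine Measure.le_iff.2 fun E hE => ?_
      rw [Measure.smul_apply, trim_measurableSet_eq h₁ hE, trim_measurableSet_eq h₁ hE,
        Measure.restrict_apply (h₁ _ hE), smul_eq_mul, mul_assoc, mul_comm (μ F)]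
      exact hμ E F hE hF
    calc ∫⁻ ω in F, f ω ∂μ = ∫⁻ ω, f ω ∂(μ.restrict F).trim h₁ := (lintegral_trim h₁ hf).symm
      _ ≤ ∫⁻ ω, f ω ∂((c * μ F) • μ.trim h₁) := lintegral_mono' hle le_rfl
      _ = c * (∫⁻ ω, f ω ∂μ) * μ F := by
        rw [lintegral_smul_measure, lintegral_trim h₁ hf, smul_eq_mul, mul_right_comm]
  have hle : (μ.withDensity f).trim h₂ ≤ (c * ∫⁻ ω, f ω ∂μ) • μ.trim h₂ := by
    refine Measure.le_iff.2 fun F hF => ?_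
    rw [Measure.smul_apply, trim_measurableSet_eq h₂ hF, trim_measurableSet_eq h₂ hF,
      withDensity_apply _ (h₂ _ hF), smul_eq_mul]
    exact hset F hF
  calc ∫⁻ ω, f ω * g ω ∂μ = ∫⁻ ω, g ω ∂(μ.withDensity f) :=
        (lintegral_withDensity_eq_lintegral_mul μ (hf.mono h₁ le_rfl) (hg.mono h₂ le_rfl)).symm
    _ = ∫⁻ ω, g ω ∂(μ.withDensity f).trim h₂ := (lintegral_trim h₂ hg).symm
    _ ≤ ∫⁻ ω, g ω ∂((c * ∫⁻ ω, f ω ∂μ) • μ.trim h₂) := lintegral_mono' hle le_rfl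
    _ = c * ((∫⁻ ω, f ω ∂μ) * ∫⁻ ω, g ω ∂μ) := by
      rw [lintegral_smul_measure, lintegral_trim h₂ hg, smul_eq_mul, mul_assoc]

/-- Partial products of nonnegative functions measurable with respect to a finite sequence of
σ-algebras, each of which satisfies an upper mixing inequality relative to its predecessors. -/
theorem lintegral_prod_le_of_measure_inter_le {Ω : Type*} {mΩ : MeasurableSpace Ω}
    {μ : Measure Ω} {d : ℕ} {𝒢 : Fin d → MeasurableSpace Ω} (h𝒢 : ∀ i, 𝒢 i ≤ mΩ) {c : ℝ≥0∞}
    (hμ : ∀ (k : ℕ) (hk : k + 1 < d) (E F : Set Ω),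
      MeasurableSet[⨆ (i : Fin d) (_ : (i : ℕ) ≤ k), 𝒢 i] E →
      MeasurableSet[𝒢 ⟨k + 1, hk⟩] F → μ (E ∩ F) ≤ c * (μ E * μ F))
    {f : Fin d → Ω → ℝ≥0∞} (hf : ∀ i, Measurable[𝒢 i] (f i)) (k : ℕ) (hk : k < d) :
    ∫⁻ ω, ∏ i with i.val ≤ k, f i ω ∂μ ≤ c ^ k * ∏ i with i.val ≤ k, ∫⁻ ω, f i ω ∂μ := by
  induction k with
  | zero =>
    have h : (Finset.univ.filter fun i : Fin d => i.val ≤ 0) = {⟨0, hk⟩} := by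
      ext i; simp [Fin.ext_iff]
    simp only [h, Finset.prod_singleton, pow_zero, one_mul, le_refl]
  | succ k ih =>
    have h : (Finset.univ.filter fun i : Fin d => i.val ≤ k + 1) =
        insert ⟨k + 1, hk⟩ (Finset.univ.filter fun i : Fin d => i.val ≤ k) := by
      ext i; simp [Fin.ext_iff]; omega
    have hnot : (⟨k + 1, hk⟩ : Fin d) ∉ Finset.univ.filter fun i : Fin d => i.val ≤ k := by simp
    have hmeas : Measurable[⨆ (i : Fin d) (_ : (i : ℕ) ≤ k), 𝒢 i]
        fun ω => ∏ i with i.val ≤ k, f i ω := by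
      refine Finset.measurable_fun_prod _ fun i hi => (hf i).mono ?_ le_rfl
      exact le_iSup₂_of_le i (Finset.mem_filter.1 hi).2 le_rfl
    simp only [h, Finset.prod_insert hnot]
    calc ∫⁻ ω, f ⟨k + 1, hk⟩ ω * ∏ i with i.val ≤ k, f i ω ∂μ
        = ∫⁻ ω, (∏ i with i.val ≤ k, f i ω) * f ⟨k + 1, hk⟩ ω ∂μ := by simp only [mul_comm]
      _ ≤ c * ((∫⁻ ω, ∏ i with i.val ≤ k, f i ω ∂μ) * ∫⁻ ω, f ⟨k + 1, hk⟩ ω ∂μ) :=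
        lintegral_mul_le_of_measure_inter_le (iSup₂_le fun i _ => h𝒢 i) (h𝒢 _) (hμ k hk)
          hmeas (hf _)
      _ ≤ c * ((c ^ k * ∏ i with i.val ≤ k, ∫⁻ ω, f i ω ∂μ) * ∫⁻ ω, f ⟨k + 1, hk⟩ ω ∂μ) := by
        gcongr
        exact ih (by omega)
      _ = _ := by ring

/-- products of nonnegative bounded random variables under an
upper ψ-mixing condition on their σ-algebras. -/
theorem stmt_4 {Ω : Type*} [mΩ : MeasurableSpace Ω] (ℙ : Measure Ω) [IsProbabilityMeasure ℙ]
    (d : ℕ) (hd : 2 ≤ d)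
    (𝒢 : Fin d → MeasurableSpace Ω) (h𝒢 : ∀ i, 𝒢 i ≤ mΩ)
    (ψ : ℝ) (hψ : 0 ≤ ψ)
    (hmix : ∀ (k : ℕ) (hk : k + 1 < d) (E F : Set Ω),
      MeasurableSet[⨆ (i : Fin d) (_ : (i : ℕ) ≤ k), 𝒢 i] E →
      MeasurableSet[𝒢 ⟨k + 1, hk⟩] F →
      ℙ (E ∩ F) ≤ ENNReal.ofReal (1 + ψ) * (ℙ E * ℙ F))
    (Y : Fin d → Ω → ℝ) (hYmeas : ∀ i, Measurable[𝒢 i] (Y i))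
    (hYpos : ∀ i ω, 0 ≤ Y i ω) (hYbdd : ∀ i, ∃ C : ℝ, ∀ ω, Y i ω ≤ C) :
    ∫ ω, (∏ i, Y i ω) ∂ℙ ≤ (1 + ψ) ^ (d - 1) * ∏ i, ∫ ω, Y i ω ∂ℙ := by
  choose C hC using hYbdd
  have hmeas : ∀ i, Measurable (Y i) := fun i => (hYmeas i).mono (h𝒢 i) le_rfl
  have hint : ∀ i, Integrable (Y i) ℙ := fun i =>
    .of_bound (hmeas i).aestronglyMeasurable (C i) <| .of_forall fun ω => by
      simpa [abs_of_nonneg (hYpos i ω)] using hC i ω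
  have hprod_nonneg : ∀ ω, 0 ≤ ∏ i, Y i ω := fun ω => Finset.prod_nonneg fun i _ => hYpos i ω
  have hprod : Integrable (fun ω => ∏ i, Y i ω) ℙ :=
    .of_bound (Finset.measurable_fun_prod _ fun i _ => hmeas i).aestronglyMeasurable (∏ i, C i) <|
      .of_forall fun ω => by
        rw [Real.norm_of_nonneg (hprod_nonneg ω)]
        exact Finset.prod_le_prod (fun i _ => hYpos i ω) fun i _ => hC i ω
  have hle := lintegral_prod_le_of_measure_inter_le h𝒢 hmix
    (fun i => (hYmeas i).ennreal_ofReal) (d - 1) (by omega)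
  have huniv : (Finset.univ.filter fun i : Fin d => i.val ≤ d - 1) = Finset.univ :=
    Finset.filter_true_of_mem fun i _ => by omega
  have hint_nonneg : ∀ i, 0 ≤ ∫ ω, Y i ω ∂ℙ := fun i => integral_nonneg (hYpos i)
  rw [← ENNReal.ofReal_le_ofReal_iff
    (mul_nonneg (by positivity) (Finset.prod_nonneg fun i _ => hint_nonneg i)),
    ofReal_integral_eq_lintegral_ofReal hprod (.of_forall hprod_nonneg),
    ENNReal.ofReal_mul (by positivity), ENNReal.ofReal_pow (by positivity),
    ENNReal.ofReal_prod_of_nonneg fun i _ => hint_nonneg i]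
  simp only [ENNReal.ofReal_prod_of_nonneg fun i _ => hYpos i _,
    ofReal_integral_eq_lintegral_ofReal (hint _) (.of_forall (hYpos _))]
  simpa only [huniv] using hle
end

section
/- Let (Ω,ℱ,ℙ) be a probability space with an invertible measure-preserving transformation θ (θ and θ⁻¹ measurable), S a measurable space, X : Ω → S measurable; set X_j := X∘θ^j for j ∈ ℤ and for I ⊆ ℤ let ℱ_I be the σ-algebra generated by {X_j : j ∈ I}. Let ρ : Ω → ℝ be measurable with 0 < ρ(ω) < 1 for all ω, and suppose that for every r ∈ ℕ there is an ℱ_{[−r,r]}-measurable ρ_r with ‖ρ − ρ_r‖_{L^∞} ≤ β_r, where β_r → 0. Let ψ : ℕ → [0,∞) be such that for all n ∈ ℤ, k ≥ 1, E ∈ ℱ_{(−∞,n]} and F ∈ ℱ_{[n+k,∞)} one has ℙ(E∩F) ≤ (1+ψ(k))ℙ(E)ℙ(F), and assume there exists s with (1+ψ(s))·E[ρ] < 1. Define R_n(ω) = ∑_{j=0}^{n−1} ∏_{u=j}^{n−1} ρ(θ^u ω). Then: (a) for every positive integer p there is a constant C_p < ∞ (independent of n) such that E[R_n^p] ≤ C_p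 for all n ≥ 1; and (b) for every ε > 0, R_n(ω)/n^ε → 0 as n → ∞ for ℙ-almost every ω. -/
open MeasureTheory Filter

/-- The two-sided iterate `θ^j`, `j ∈ ℤ`, of an invertible transformation `θ`
with inverse `θinv`. -/
def zIter {Ω : Type*} (θ θinv : Ω → Ω) : ℤ → Ω → Ω
  | Int.ofNat n => θ^[n]
  | Int.negSucc n => θinv^[n + 1]

/-- The σ-algebra `ℱ_I` generated by the random variables `X_j = X ∘ θ^j`, `j ∈ I`. -/
def fiberAlg {Ω S : Type*} [MeasurableSpace S] (θ θinv : Ω → Ω) (X : Ω → S)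
    (I : Set ℤ) : MeasurableSpace Ω :=
  ⨆ j ∈ I, MeasurableSpace.comap (fun ω => X (zIter θ θinv j ω)) inferInstance

lemma zIter_apply {Ω : Type*} {θ θinv : Ω → Ω} (h : Function.LeftInverse θinv θ) (j : ℤ) (ω : Ω) :
    zIter θ θinv j (θ ω) = zIter θ θinv (j + 1) ω := by
  rcases j with n | n
  · rfl
  · rcases n with _ | n
    · exact h ω
    · change θinv^[n + 1 + 1] (θ ω) = θinv^[n + 1] ω
      rw [Function.iterate_succ_apply, h ω]

lemma zIter_iterate_apply {Ω : Type*} {θ θinv : Ω → Ω} (h : Function.LeftInverse θinv θ)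
    (j : ℤ) (k : ℕ) (ω : Ω) :
    zIter θ θinv j (θ^[k] ω) = zIter θ θinv (j + k) ω := by
  induction k generalizing j with
  | zero => simp
  | succ k ih =>
    rw [Function.iterate_succ_apply', zIter_apply h, ih]
    congr 1
    push_cast
    ring

lemma measurable_zIter {Ω : Type*} [MeasurableSpace Ω] {θ θinv : Ω → Ω}
    (hθ : Measurable θ) (hθinv : Measurable θinv) (j : ℤ) : Measurable (zIter θ θinv j) := by
  rcases j with n | n
  · exact hθ.iterate n
  · exact hθinv.iterate (n + 1)

section FiberAlg

variable {Ω S : Type*} [MeasurableSpace S] {θ θinv : Ω → Ω} {X : Ω → S}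

lemma fiberAlg_le [mΩ : MeasurableSpace Ω] (hθ : Measurable θ) (hθinv : Measurable θinv)
    (hX : Measurable X) (I : Set ℤ) : fiberAlg θ θinv X I ≤ mΩ :=
  iSup₂_le fun j _ => (hX.comp (measurable_zIter hθ hθinv j)).comap_le

lemma measurableSet_fiberAlg_preimage_iterate (h : Function.LeftInverse θinv θ)
    {I J : Set ℤ} {k : ℕ} (hIJ : ∀ i ∈ I, i + k ∈ J) {A : Set Ω}
    (hA : MeasurableSet[fiberAlg θ θinv X I] A) :
    MeasurableSet[fiberAlg θ θinv X J] (θ^[k] ⁻¹' A) := by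
  have hle : (fiberAlg θ θinv X I).comap θ^[k] ≤ fiberAlg θ θinv X J := by
    unfold fiberAlg
    simp only [MeasurableSpace.comap_iSup, MeasurableSpace.comap_comp]
    refine iSup₂_le fun i hi => ?_
    refine le_trans (le_of_eq ?_) (le_iSup₂ (i + (k : ℤ)) (hIJ i hi))
    congr 1
    funext ω
    simp [zIter_iterate_apply h]
  exact hle _ ⟨A, hA, rfl⟩

/-- If the process has finite upper `ψ`-mixing coefficient at gap one, then the probability that
an event `A` depending on a window of radius `r` occurs at all times of a finite set separated by
`2 r + 1` is geometrically small. -/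
lemma measureReal_biInter_preimage_iterate_le [mΩ : MeasurableSpace Ω]
    {ℙ : Measure Ω} [IsProbabilityMeasure ℙ]
    (hinv : Function.LeftInverse θinv θ) (hmp : MeasurePreserving θ ℙ ℙ)
    (hle : ∀ I, fiberAlg θ θinv X I ≤ mΩ) {K : ℝ} (hK : 0 ≤ K)
    (hmix : ∀ (n : ℤ) (E F : Set Ω),
      MeasurableSet[fiberAlg θ θinv X (Set.Iic n)] E →
      MeasurableSet[fiberAlg θ θinv X (Set.Ici (n + 1))] F →
      ℙ (E ∩ F) ≤ ENNReal.ofReal K * (ℙ E * ℙ F))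
    {r : ℕ} {A : Set Ω} (hA : MeasurableSet[fiberAlg θ θinv X (Set.Icc (-(r : ℤ)) r)] A)
    (s : Finset ℕ) :
    ℙ.real (⋂ i ∈ s, θ^[(2 * r + 1) * i] ⁻¹' A) ≤ (K * ℙ.real A) ^ s.card := by
  induction s using Finset.induction_on_max with
  | empty => simp
  | insert a s hlt ih =>
    have ha : a ∉ s := fun h => lt_irrefl _ (hlt a h)
    rw [Finset.set_biInter_insert, Finset.card_insert_of_notMem ha, Set.inter_comm, pow_succ]
    have hE : MeasurableSet[fiberAlg θ θinv X (Set.Iic (((2 * r + 1) * a : ℕ) - r - 1 : ℤ))]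
        (⋂ i ∈ s, θ^[(2 * r + 1) * i] ⁻¹' A) := by
      refine Finset.measurableSet_biInter _ fun i hi => ?_
      refine measurableSet_fiberAlg_preimage_iterate hinv (fun j hj => ?_) hA
      have h1 : (i : ℤ) + 1 ≤ a := by exact_mod_cast hlt i hi
      have h2 := hj.2
      simp only [Set.mem_Iic]
      push_cast
      nlinarith
    have hF : MeasurableSet[fiberAlg θ θinv X
        (Set.Ici ((((2 * r + 1) * a : ℕ) - r - 1 : ℤ) + 1))] (θ^[(2 * r + 1) * a] ⁻¹' A) := by
      refine measurableSet_fiberAlg_preimage_iterate hinv (fun j hj => ?_) hA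
      have h2 := hj.1
      simp only [Set.mem_Ici]
      linarith
    have h := ENNReal.toReal_mono (by finiteness) (hmix _ _ _ hE hF)
    rw [ENNReal.toReal_mul, ENNReal.toReal_mul, ENNReal.toReal_ofReal hK,
      (hmp.iterate _).measure_preimage (hle _ _ hA).nullMeasurableSet] at h
    calc ℙ.real _ ≤ _ := h
      _ = ℙ.real (⋂ i ∈ s, θ^[(2 * r + 1) * i] ⁻¹' A) * (K * ℙ.real A) := by
        simp only [Measure.real]; ring
      _ ≤ _ := by gcongr

end FiberAlg

/-- If intersections of the `A i` have geometrically small probability, then so does the mean of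
a product of the factors `1 - η + η 1_{A i}`. -/
lemma integral_prod_indicator_le {Ω : Type*} [MeasurableSpace Ω] {ℙ : Measure Ω}
    [IsProbabilityMeasure ℙ] {A : ℕ → Set Ω} (hA : ∀ i, MeasurableSet (A i)) {q η : ℝ}
    (hη0 : 0 ≤ η) (hη1 : η ≤ 1)
    (hq : ∀ s : Finset ℕ, ℙ.real (⋂ i ∈ s, A i) ≤ q ^ s.card) (N : ℕ) :
    ∫ ω, ∏ i ∈ Finset.range N, (η * (A i).indicator 1 ω + (1 - η)) ∂ℙ
      ≤ (η * q + (1 - η)) ^ N := by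
  have hprod : ∀ (s : Finset ℕ) (ω : Ω), ∏ i ∈ s, (A i).indicator (1 : Ω → ℝ) ω
      = (⋂ i ∈ s, A i).indicator 1 ω := by
    intro s ω
    by_cases h : ω ∈ ⋂ i ∈ s, A i
    · rw [Set.indicator_of_mem h]
      refine Finset.prod_eq_one fun i hi => ?_
      rw [Set.indicator_of_mem (Set.mem_iInter₂.1 h i hi)]
      rfl
    · rw [Set.indicator_of_notMem h]
      obtain ⟨i, hi, hiA⟩ : ∃ i ∈ s, ω ∉ A i := by simpa using h
      exact Finset.prod_eq_zero hi (Set.indicator_of_notMem hiA _)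
  have hmeas : ∀ s : Finset ℕ, MeasurableSet (⋂ i ∈ s, A i) := fun s =>
    Finset.measurableSet_biInter _ fun i _ => hA i
  simp only [Finset.prod_add, Finset.prod_mul_distrib, hprod, Finset.prod_const]
  rw [integral_finsetSum]
  · have hpow : (η * q + (1 - η)) ^ N = ∑ s ∈ (Finset.range N).powerset,
        η ^ s.card * q ^ s.card * (1 - η) ^ (Finset.range N \ s).card := by
      rw [← Finset.card_range N, ← Finset.prod_const, Finset.prod_add]
      simp [mul_pow]
    rw [hpow]
    refine Finset.sum_le_sum fun s _ => ?_
    rw [integral_mul_const, integral_const_mul, integral_indicator_one (hmeas s)]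
    have := hq s
    have := sub_nonneg.2 hη1
    gcongr
  · intro s _
    refine Integrable.mul_const (Integrable.const_mul ?_ _) _
    exact (integrable_const (1 : ℝ)).indicator (hmeas s)

lemma add_pow_succ_le {S a : ℝ} (hS : 0 ≤ S) (ha : 0 ≤ a) (p : ℕ) :
    (S + a) ^ (p + 1) ≤ S ^ (p + 1) + (p + 1) * (S + a) ^ p * a := by
  induction p with
  | zero => simp
  | succ p ih =>
    have h1 := mul_le_mul_of_nonneg_left ih hS
    have h2 : 0 ≤ (p + 1 : ℝ) * (S + a) ^ p * a * a := by positivity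
    push_cast
    calc (S + a) ^ (p + 1 + 1) = S * (S + a) ^ (p + 1) + a * (S + a) ^ (p + 1) := by ring
      _ ≤ S * (S ^ (p + 1) + (p + 1) * (S + a) ^ p * a) + a * (S + a) ^ (p + 1)
          + (p + 1 : ℝ) * (S + a) ^ p * a * a := by linarith
      _ = _ := by ring

lemma sum_pow_succ_le {a : ℕ → ℝ} (h0 : ∀ i, 0 ≤ a i) (h1 : ∀ i, a i ≤ 1) (p n : ℕ) :
    (∑ i ∈ Finset.range n, a i) ^ (p + 1)
      ≤ ∑ i ∈ Finset.range n, (p + 1) * ((i : ℝ) + 1) ^ p * a i := by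
  induction n with
  | zero => simp
  | succ n ih =>
    rw [Finset.sum_range_succ, Finset.sum_range_succ]
    have hS : 0 ≤ ∑ i ∈ Finset.range n, a i := Finset.sum_nonneg fun i _ => h0 i
    have hle : ∑ i ∈ Finset.range n, a i ≤ n := by
      simpa using Finset.sum_le_card_nsmul (Finset.range n) a 1 fun i _ => h1 i
    refine (add_pow_succ_le hS (h0 n) p).trans ?_
    have := h0 n
    have := h1 n
    gcongr

/-- Nonnegative functions whose `p`-th moments are summable tend to zero almost everywhere. -/
lemma ae_tendsto_zero_of_integral_pow_le {Ω : Type*} [MeasurableSpace Ω] {ℙ : Measure Ω}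
    {f : ℕ → Ω → ℝ} {p : ℕ} (hp : p ≠ 0) (hf0 : ∀ n ω, 0 ≤ f n ω)
    (hf : ∀ n, Integrable (fun ω => f n ω ^ p) ℙ)
    {c : ℕ → ℝ} (hc : Summable c) (hle : ∀ n, ∫ ω, f n ω ^ p ∂ℙ ≤ c n) :
    ∀ᵐ ω ∂ℙ, Tendsto (fun n => f n ω) atTop (nhds 0) := by
  have hfin : ∫⁻ ω, ∑' n, ENNReal.ofReal (f n ω ^ p) ∂ℙ ≠ ⊤ := by
    rw [lintegral_tsum fun n => (hf n).aemeasurable.ennreal_ofReal]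
    refine ne_top_of_le_ne_top hc.tsum_ofReal_ne_top (ENNReal.tsum_le_tsum fun n => ?_)
    rw [← ofReal_integral_eq_lintegral_ofReal (hf n)
      (Eventually.of_forall fun ω => pow_nonneg (hf0 n ω) p)]
    exact ENNReal.ofReal_le_ofReal (hle n)
  have hmeas : AEMeasurable (fun ω => ∑' n, ENNReal.ofReal (f n ω ^ p)) ℙ :=
    AEMeasurable.tsum fun n => (hf n).aemeasurable.ennreal_ofReal
  filter_upwards [ae_lt_top' hmeas hfin] with ω hω
  have h1 := ENNReal.tendsto_atTop_zero_of_tsum_ne_top hω.ne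
  have h2 : Tendsto (fun n => f n ω ^ p) atTop (nhds 0) := by
    have := (ENNReal.tendsto_toReal ENNReal.zero_ne_top).comp h1
    refine this.congr fun n => ?_
    exact ENNReal.toReal_ofReal (pow_nonneg (hf0 n ω) p)
  have h3 := h2.rpow_const (p := (p : ℝ)⁻¹) (Or.inr (by positivity))
  rw [Real.zero_rpow (by positivity)] at h3
  exact h3.congr fun n => Real.pow_rpow_inv_natCast (hf0 n ω) hp

lemma exists_measureReal_lt {Ω : Type*} [MeasurableSpace Ω] {ℙ : Measure Ω}
    [IsProbabilityMeasure ℙ] {ρ : Ω → ℝ} (hρm : Measurable ρ) (hρ : ∀ ω, ρ ω < 1)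
    {c : ℝ} (hc : 0 < c) :
    ∃ e : ℝ, 0 < e ∧ e ≤ 1 ∧ ℙ.real {ω | 1 - e < ρ ω} < c := by
  have h := tendsto_measure_iInter_atTop (μ := ℙ)
    (s := fun n : ℕ => {ω | 1 - 1 / ((n : ℝ) + 1) < ρ ω})
    (fun n => (measurableSet_lt measurable_const hρm).nullMeasurableSet)
    (fun m n hmn ω hω => by
      have : 1 / ((n : ℝ) + 1) ≤ 1 / ((m : ℝ) + 1) := by gcongr
      simp only [Set.mem_ofPred_eq] at hω ⊢
      linarith)
    ⟨0, by finiteness⟩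
  have hempty : ⋂ n : ℕ, {ω | 1 - 1 / ((n : ℝ) + 1) < ρ ω} = ∅ := by
    ext ω
    simp only [Set.mem_iInter, Set.mem_ofPred_eq, Set.mem_empty_iff_false, iff_false, not_forall,
      not_lt]
    obtain ⟨n, hn⟩ := exists_nat_one_div_lt (sub_pos.2 (hρ ω))
    exact ⟨n, by linarith⟩
  rw [hempty, measure_empty] at h
  have h' := (ENNReal.tendsto_toReal ENNReal.zero_ne_top).comp h
  obtain ⟨n, hn⟩ := (h'.eventually (gt_mem_nhds (by simpa using hc))).exists
  refine ⟨1 / ((n : ℝ) + 1), by positivity, ?_, hn⟩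
  rw [div_le_one (by positivity)]
  linarith [(Nat.cast_nonneg n : (0 : ℝ) ≤ n)]

lemma exists_pow_div_le_mul_pow {δ₀ : ℝ} (h0 : 0 < δ₀) (h1 : δ₀ < 1) {m : ℕ} (hm : 0 < m) :
    ∃ C δ : ℝ, 0 < δ ∧ δ < 1 ∧ ∀ l : ℕ, δ₀ ^ (l / m) ≤ C * δ ^ l := by
  have hδm : (δ₀ ^ (m : ℝ)⁻¹) ^ m = δ₀ := Real.rpow_inv_natCast_pow h0.le hm.ne'
  have hδ1 : δ₀ ^ (m : ℝ)⁻¹ < 1 := Real.rpow_lt_one h0.le h1 (by positivity)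
  refine ⟨δ₀⁻¹, δ₀ ^ (m : ℝ)⁻¹, by positivity, hδ1, fun l => ?_⟩
  have h := pow_le_pow_of_le_one (by positivity : 0 ≤ δ₀ ^ (m : ℝ)⁻¹) hδ1.le
    (Nat.lt_mul_div_succ l hm).le
  rw [pow_mul, hδm, pow_succ] at h
  rw [inv_mul_eq_div, le_div_iff₀ h0]
  exact h

lemma measurable_prod_iterate {Ω : Type*} [MeasurableSpace Ω] {θ : Ω → Ω} (hθ : Measurable θ)
    {ρ : Ω → ℝ} (hρ : Measurable ρ) (s : Finset ℕ) :
    Measurable fun ω => ∏ u ∈ s, ρ (θ^[u] ω) :=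
  Finset.measurable_fun_prod _ fun u _ => hρ.comp (hθ.iterate u)

lemma integral_prod_Ico_iterate {Ω : Type*} [MeasurableSpace Ω] {ℙ : Measure Ω} {θ : Ω → Ω}
    (hmp : MeasurePreserving θ ℙ ℙ) {ρ : Ω → ℝ} (hρ : Measurable ρ) (j n : ℕ) :
    ∫ ω, ∏ u ∈ Finset.Ico j n, ρ (θ^[u] ω) ∂ℙ
      = ∫ ω, ∏ u ∈ Finset.range (n - j), ρ (θ^[u] ω) ∂ℙ := by
  have h := hmp.iterate j
  conv_rhs => rw [← h.map_eq]
  rw [integral_map h.measurable.aemeasurable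
    (measurable_prod_iterate hmp.measurable hρ _).aestronglyMeasurable]
  simp only [Finset.prod_Ico_eq_prod_range, ← Function.iterate_add_apply, add_comm j]

lemma prod_iterate_mem_Icc {Ω : Type*} {θ : Ω → Ω} {ρ : Ω → ℝ}
    (hρ : ∀ ω, ρ ω ∈ Set.Ioo (0 : ℝ) 1) (s : Finset ℕ) (ω : Ω) :
    ∏ u ∈ s, ρ (θ^[u] ω) ∈ Set.Icc (0 : ℝ) 1 :=
  ⟨Finset.prod_nonneg fun _ _ => (hρ _).1.le,
    Finset.prod_le_one (fun _ _ => (hρ _).1.le) fun _ _ => (hρ _).2.le⟩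

section Contraction

variable {Ω : Type*} [MeasurableSpace Ω] {ℙ : Measure Ω} [IsProbabilityMeasure ℙ]
  {θ : Ω → Ω} {ρ : Ω → ℝ}

lemma integrable_of_mem_Icc {f : Ω → ℝ} (hf : Measurable f) {a b : ℝ}
    (h : ∀ ω, f ω ∈ Set.Icc a b) : Integrable f ℙ :=
  Integrable.of_mem_Icc a b hf.aemeasurable (Eventually.of_forall h)

/-- Exponential decay of the mean contraction along orbits, when `ρ ≤ 1 - η` off an event whose
occurrences at multiples of `m` are quasi-independent. -/
lemma integral_prod_range_iterate_le (hmp : MeasurePreserving θ ℙ ℙ) (hρm : Measurable ρ)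
    (hρ : ∀ ω, ρ ω ∈ Set.Ioo (0 : ℝ) 1) {A : Set Ω} (hA : MeasurableSet A) {q η : ℝ}
    (hη0 : 0 ≤ η) (hη1 : η ≤ 1) (hAρ : ∀ᵐ ω ∂ℙ, ω ∉ A → ρ ω ≤ 1 - η) {m : ℕ} (hm : 0 < m)
    (hq : ∀ s : Finset ℕ, ℙ.real (⋂ i ∈ s, θ^[m * i] ⁻¹' A) ≤ q ^ s.card) (l : ℕ) :
    ∫ ω, ∏ u ∈ Finset.range l, ρ (θ^[u] ω) ∂ℙ ≤ (η * q + (1 - η)) ^ (l / m) := by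
  have hAi : ∀ i, MeasurableSet (θ^[m * i] ⁻¹' A) := fun i => (hmp.measurable.iterate _) hA
  refine le_trans (integral_mono_ae ?_ ?_ ?_)
    (integral_prod_indicator_le hAi hη0 hη1 hq (l / m))
  · exact integrable_of_mem_Icc (measurable_prod_iterate hmp.measurable hρm _)
      (prod_iterate_mem_Icc hρ _)
  · have hmem : ∀ i ω, η * (θ^[m * i] ⁻¹' A).indicator 1 ω + (1 - η) ∈ Set.Icc (0 : ℝ) 1 := by
      intro i ω
      by_cases h : ω ∈ θ^[m * i] ⁻¹' A
      · rw [Set.indicator_of_mem h]; simp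
      · rw [Set.indicator_of_notMem h]; simp [hη0, hη1]
    refine integrable_of_mem_Icc (a := 0) (b := 1) ?_ fun ω =>
      ⟨Finset.prod_nonneg fun i _ => (hmem i ω).1,
        Finset.prod_le_one (fun i _ => (hmem i ω).1) fun i _ => (hmem i ω).2⟩
    exact Finset.measurable_fun_prod _ fun i _ =>
      ((measurable_one.indicator (hAi i)).const_mul η).add_const _
  · have hall : ∀ᵐ ω ∂ℙ, ∀ i : ℕ, θ^[m * i] ω ∉ A → ρ (θ^[m * i] ω) ≤ 1 - η :=
      ae_all_iff.2 fun i => (hmp.iterate (m * i)).quasiMeasurePreserving.ae hAρ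
    filter_upwards [hall] with ω hω
    have hinj : Function.Injective fun i : ℕ => m * i := fun a b h =>
      Nat.eq_of_mul_eq_mul_left hm h
    have hsub : (Finset.range (l / m)).image (fun i => m * i) ⊆ Finset.range l := by
      intro u hu
      obtain ⟨i, hi, rfl⟩ := Finset.mem_image.1 hu
      rw [Finset.mem_range] at hi ⊢
      calc m * i < m * (l / m) := by gcongr
        _ ≤ l := Nat.mul_div_le l m
    calc ∏ u ∈ Finset.range l, ρ (θ^[u] ω)
        ≤ ∏ u ∈ (Finset.range (l / m)).image (fun i => m * i), ρ (θ^[u] ω) :=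
          Finset.prod_le_prod_of_subset_of_le_one hsub (fun _ _ => (hρ _).1.le)
            fun _ _ _ => (hρ _).2.le
      _ = ∏ i ∈ Finset.range (l / m), ρ (θ^[m * i] ω) :=
          Finset.prod_image hinj.injOn
      _ ≤ _ := by
        refine Finset.prod_le_prod (fun _ _ => (hρ _).1.le) fun i _ => ?_
        by_cases h : ω ∈ θ^[m * i] ⁻¹' A
        · rw [Set.indicator_of_mem h]; simpa using (hρ _).2.le
        · rw [Set.indicator_of_notMem h]; simpa using hω i h

lemma exists_integral_sum_pow_le (hmp : MeasurePreserving θ ℙ ℙ) (hρm : Measurable ρ)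
    (hρ : ∀ ω, ρ ω ∈ Set.Ioo (0 : ℝ) 1) {C δ : ℝ} (hδ0 : 0 < δ) (hδ1 : δ < 1)
    (hdecay : ∀ l : ℕ, ∫ ω, ∏ u ∈ Finset.range l, ρ (θ^[u] ω) ∂ℙ ≤ C * δ ^ l)
    (p : ℕ) (hp : 0 < p) :
    ∃ M : ℝ, ∀ n : ℕ,
      ∫ ω, (∑ j ∈ Finset.range n, ∏ u ∈ Finset.Ico j n, ρ (θ^[u] ω)) ^ p ∂ℙ ≤ M := by
  obtain ⟨p, rfl⟩ : ∃ k, p = k + 1 := ⟨p - 1, by omega⟩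
  have hC : 0 ≤ C := by
    have := hdecay 0
    simp at this
    linarith
  have hsum : Summable fun i : ℕ => (p + 1) * ((i : ℝ) + 1) ^ p * (C * δ ^ (i + 1)) := by
    have h := summable_pow_mul_geometric_of_norm_lt_one (R := ℝ) p (r := δ)
      (by rwa [Real.norm_of_nonneg hδ0.le])
    refine (((summable_nat_add_iff 1).2 h).mul_left ((p + 1) * C)).congr fun i => ?_
    push_cast
    ring
  have hnn : ∀ i : ℕ, 0 ≤ (p + 1) * ((i : ℝ) + 1) ^ p * (C * δ ^ (i + 1)) := fun i => by
    positivity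
  refine ⟨∑' i : ℕ, (p + 1) * ((i : ℝ) + 1) ^ p * (C * δ ^ (i + 1)), fun n => ?_⟩
  have hint : ∀ i : ℕ, Integrable (fun ω => (p + 1) * ((i : ℝ) + 1) ^ p *
      ∏ u ∈ Finset.Ico (n - 1 - i) n, ρ (θ^[u] ω)) ℙ := fun i =>
    (integrable_of_mem_Icc (measurable_prod_iterate hmp.measurable hρm _)
      (prod_iterate_mem_Icc hρ _)).const_mul _
  calc ∫ ω, (∑ j ∈ Finset.range n, ∏ u ∈ Finset.Ico j n, ρ (θ^[u] ω)) ^ (p + 1) ∂ℙ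
      ≤ ∫ ω, ∑ i ∈ Finset.range n, (p + 1) * ((i : ℝ) + 1) ^ p *
          ∏ u ∈ Finset.Ico (n - 1 - i) n, ρ (θ^[u] ω) ∂ℙ := by
        refine integral_mono_of_nonneg (Eventually.of_forall fun ω => ?_)
          (integrable_finsetSum _ fun i _ => hint i) (Eventually.of_forall fun ω => ?_)
        · exact pow_nonneg (Finset.sum_nonneg fun j _ => (prod_iterate_mem_Icc hρ _ ω).1) _
        · dsimp only
          rw [← Finset.sum_range_reflect]
          exact sum_pow_succ_le (fun i => (prod_iterate_mem_Icc hρ _ ω).1)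
            (fun i => (prod_iterate_mem_Icc hρ _ ω).2) p n
    _ = ∑ i ∈ Finset.range n, (p + 1) * ((i : ℝ) + 1) ^ p *
          ∫ ω, ∏ u ∈ Finset.Ico (n - 1 - i) n, ρ (θ^[u] ω) ∂ℙ := by
        rw [integral_finsetSum _ fun i _ => hint i]
        simp only [integral_const_mul]
    _ ≤ ∑ i ∈ Finset.range n, (p + 1) * ((i : ℝ) + 1) ^ p * (C * δ ^ (i + 1)) := by
        refine Finset.sum_le_sum fun i hi => ?_
        have hin := Finset.mem_range.1 hi
        rw [integral_prod_Ico_iterate hmp hρm, show n - (n - 1 - i) = i + 1 by omega]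
        gcongr
        exact hdecay (i + 1)
    _ ≤ _ := hsum.sum_le_tsum _ fun i _ => hnn i

lemma ae_tendsto_sum_div_rpow (hθ : Measurable θ) (hρm : Measurable ρ)
    (hρ : ∀ ω, ρ ω ∈ Set.Ioo (0 : ℝ) 1)
    (hmom : ∀ p : ℕ, 0 < p → ∃ M : ℝ, ∀ n : ℕ,
      ∫ ω, (∑ j ∈ Finset.range n, ∏ u ∈ Finset.Ico j n, ρ (θ^[u] ω)) ^ p ∂ℙ ≤ M)
    {ε : ℝ} (hε : 0 < ε) :
    ∀ᵐ ω ∂ℙ, Tendsto (fun n : ℕ =>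
        (∑ j ∈ Finset.range n, ∏ u ∈ Finset.Ico j n, ρ (θ^[u] ω)) / (n : ℝ) ^ ε)
      atTop (nhds 0) := by
  obtain ⟨p, hp⟩ := exists_nat_gt (1 / ε)
  have hp0 : 0 < p := by
    have : (0 : ℝ) < p := lt_trans (by positivity) hp
    exact_mod_cast this
  have hεp : 1 < ε * p := by rwa [div_lt_iff₀' hε] at hp
  obtain ⟨M, hM⟩ := hmom p hp0
  have hS0 : ∀ n ω, 0 ≤ ∑ j ∈ Finset.range n, ∏ u ∈ Finset.Ico j n, ρ (θ^[u] ω) := fun n ω =>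
    Finset.sum_nonneg fun j _ => (prod_iterate_mem_Icc hρ _ ω).1
  have hSn : ∀ n ω, ∑ j ∈ Finset.range n, ∏ u ∈ Finset.Ico j n, ρ (θ^[u] ω) ≤ n := fun n ω => by
    simpa using Finset.sum_le_card_nsmul (Finset.range n) _ 1
      fun j _ => (prod_iterate_mem_Icc (θ := θ) hρ (Finset.Ico j n) ω).2
  have hSm : ∀ n, Measurable fun ω =>
      ∑ j ∈ Finset.range n, ∏ u ∈ Finset.Ico j n, ρ (θ^[u] ω) := fun n =>
    Finset.measurable_fun_sum _ fun j _ => measurable_prod_iterate hθ hρm _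
  have hpow : ∀ n : ℕ, ((n : ℝ) ^ ε) ^ p = (n : ℝ) ^ (ε * p) := fun n =>
    (Real.rpow_mul_natCast n.cast_nonneg ε p).symm
  refine ae_tendsto_zero_of_integral_pow_le (p := p)
    (c := fun n : ℕ => M * (1 / (n : ℝ) ^ (ε * p)))
    hp0.ne' (fun n ω => div_nonneg (hS0 n ω) (by positivity)) (fun n => ?_)
    ((Real.summable_one_div_nat_rpow.2 hεp).mul_left M) fun n => ?_
  · simp only [div_pow]
    refine Integrable.div_const (integrable_of_mem_Icc (a := 0) (b := (n : ℝ) ^ p)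
      ((hSm n).pow_const p) fun ω => ⟨pow_nonneg (hS0 n ω) p, ?_⟩) _
    exact pow_le_pow_left₀ (hS0 n ω) (hSn n ω) p
  · simp only [div_pow, hpow]
    rw [integral_div, div_eq_mul_one_div]
    gcongr
    exact hM n

end Contraction

/-- uniform moment bounds and a.s. polynomial negligibility of
`R_n(ω) = ∑_{j<n} ∏_{u=j}^{n-1} ρ(θ^u ω)` under upper ψ-mixing and `L^∞`
approximability of `ρ`. -/
theorem stmt_9 {Ω S : Type*} [mΩ : MeasurableSpace Ω] [MeasurableSpace S]
    (ℙ : Measure Ω) [IsProbabilityMeasure ℙ]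
    (θ θinv : Ω → Ω) (hθ : Measurable θ) (hθinv : Measurable θinv)
    (hinv1 : Function.LeftInverse θinv θ) (hinv2 : Function.RightInverse θinv θ)
    (hmp : MeasurePreserving θ ℙ ℙ)
    (X : Ω → S) (hX : Measurable X)
    (ρ : Ω → ℝ) (hρmeas : Measurable ρ) (hρ : ∀ ω, ρ ω ∈ Set.Ioo (0 : ℝ) 1)
    (β : ℕ → ℝ) (hβ0 : Tendsto β atTop (nhds 0))
    (happrox : ∀ r : ℕ, ∃ ρr : Ω → ℝ,
      Measurable[fiberAlg θ θinv X (Set.Icc (-(r : ℤ)) r)] ρr ∧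
        ∀ᵐ ω ∂ℙ, |ρ ω - ρr ω| ≤ β r)
    (ψ : ℕ → ℝ) (hψ : ∀ k, 0 ≤ ψ k)
    (hmix : ∀ (n : ℤ) (k : ℕ), 1 ≤ k → ∀ E F : Set Ω,
      MeasurableSet[fiberAlg θ θinv X (Set.Iic n)] E →
      MeasurableSet[fiberAlg θ θinv X (Set.Ici (n + (k : ℤ)))] F →
      ℙ (E ∩ F) ≤ ENNReal.ofReal (1 + ψ k) * (ℙ E * ℙ F))
    (hgap : ∃ s : ℕ, (1 + ψ s) * ∫ ω, ρ ω ∂ℙ < 1) :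
    (∀ p : ℕ, 0 < p → ∃ C : ℝ, ∀ n : ℕ, 1 ≤ n →
      ∫ ω, (∑ j ∈ Finset.range n, ∏ u ∈ Finset.Ico j n, ρ (θ^[u] ω)) ^ p ∂ℙ ≤ C) ∧
      (∀ ε : ℝ, 0 < ε → ∀ᵐ ω ∂ℙ,
        Tendsto (fun n : ℕ =>
            (∑ j ∈ Finset.range n, ∏ u ∈ Finset.Ico j n, ρ (θ^[u] ω)) / (n : ℝ) ^ ε)
          atTop (nhds 0)) := by
  have hK : 0 < 1 + ψ 1 := by linarith [hψ 1]
  obtain ⟨e, he0, he1, he⟩ := exists_measureReal_lt (ℙ := ℙ) hρmeas (fun ω => (hρ ω).2)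
    (c := 1 / (1 + ψ 1)) (by positivity)
  obtain ⟨r, hr⟩ := (hβ0.eventually (gt_mem_nhds (by positivity : 0 < e / 3))).exists
  obtain ⟨ρr, hρr, hclose⟩ := happrox r
  have hle := fiberAlg_le hθ hθinv hX
  have hA : MeasurableSet[fiberAlg θ θinv X (Set.Icc (-(r : ℤ)) r)] {ω | 1 - 2 * (e / 3) < ρr ω} :=
    hρr measurableSet_Ioi
  have hPA : ℙ.real {ω | 1 - 2 * (e / 3) < ρr ω} ≤ ℙ.real {ω | 1 - e < ρ ω} := by
    refine ENNReal.toReal_mono (by finiteness) (measure_mono_ae ?_)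
    filter_upwards [hclose] with ω hω hωA
    change 1 - 2 * (e / 3) < ρr ω at hωA
    change 1 - e < ρ ω
    linarith [(abs_le.1 hω).1]
  have hAρ : ∀ᵐ ω ∂ℙ, ω ∉ {ω | 1 - 2 * (e / 3) < ρr ω} → ρ ω ≤ 1 - e / 3 := by
    filter_upwards [hclose] with ω hω hωA
    simp only [not_lt] at hωA
    linarith [(abs_le.1 hω).2]
  have hq := measureReal_biInter_preimage_iterate_le hinv1 hmp hle hK.le
    (fun n E F hE hF => hmix n 1 le_rfl E F hE (by simpa using hF)) hA
  have hq0 : 0 ≤ (1 + ψ 1) * ℙ.real {ω | 1 - 2 * (e / 3) < ρr ω} := by positivity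
  have hq1 : (1 + ψ 1) * ℙ.real {ω | 1 - 2 * (e / 3) < ρr ω} < 1 := by
    rw [← lt_div_iff₀' hK]
    exact hPA.trans_lt he
  obtain ⟨C, δ, hδ0, hδ1, hδ⟩ := exists_pow_div_le_mul_pow
    (δ₀ := e / 3 * ((1 + ψ 1) * ℙ.real {ω | 1 - 2 * (e / 3) < ρr ω}) + (1 - e / 3))
    (by nlinarith) (by nlinarith) (Nat.succ_pos (2 * r))
  have hmom := exists_integral_sum_pow_le hmp hρmeas hρ hδ0 hδ1 fun l =>
    (integral_prod_range_iterate_le hmp hρmeas hρ (hle _ _ hA) (by positivity) (by linarith)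
      hAρ (Nat.succ_pos (2 * r)) hq l).trans (hδ l)
  refine ⟨fun p hp => ?_, fun ε hε => ae_tendsto_sum_div_rpow hθ hρmeas hρ hmom hε⟩
  obtain ⟨M, hM⟩ := hmom p hp
  exact ⟨M, fun n _ => hM n⟩
end

section
/- Let (X,d) be a metric space, α ∈ (0,1], and a ≥ 1. Let 𝒞 be the set of all bounded continuous functions g : X → ℝ such that g ≥ 0 and g(x) ≤ exp(a·d(x,x')^α)·g(x') for all x,x' ∈ X. Let μ be a linear functional on the space of bounded continuous real-valued functions on X such that μ(g) ≥ 0 for every g ∈ 𝒞. Then for every bounded continuous h : X → ℝ with finite α-Hölder seminorm v_α(h), one has |μ(h)| ≤ 2·(sup_X|h| + v_α(h))·μ(1), where 1 denotes the constant function one. -/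
open scoped BoundedContinuousFunction

/-- The α-Hölder seminorm of `h`, defined as the least nonnegative constant `C`
with `|h x - h x'| ≤ C · d(x,x')^α` (junk value `0` if no such constant exists). -/
noncomputable def vHolder {X : Type*} [PseudoMetricSpace X] (α : ℝ) (h : X → ℝ) : ℝ :=
  sInf {C : ℝ | 0 ≤ C ∧ ∀ x x', |h x - h x'| ≤ C * dist x x' ^ α}

theorem vHolder_nonneg {X : Type*} [PseudoMetricSpace X] (α : ℝ) (h : X → ℝ) :
    0 ≤ vHolder α h :=
  Real.sInf_nonneg fun _ hC => hC.1

/-- The infimum defining the Hölder seminorm is attained. -/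
theorem abs_sub_le_vHolder_mul {X : Type*} [MetricSpace X] {α : ℝ} {h : X → ℝ}
    (hh : ∃ C : ℝ, 0 ≤ C ∧ ∀ x x', |h x - h x'| ≤ C * dist x x' ^ α) (x x' : X) :
    |h x - h x'| ≤ vHolder α h * dist x x' ^ α := by
  rcases eq_or_ne x x' with rfl | hne
  · have hD : 0 ≤ dist x x ^ α := Real.rpow_nonneg dist_nonneg α
    rw [sub_self, abs_zero]
    exact mul_nonneg (vHolder_nonneg α h) hD
  · have hD : 0 < dist x x' ^ α := Real.rpow_pos_of_pos (dist_pos.2 hne) α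
    rw [← div_le_iff₀ hD]
    exact le_csInf hh fun C hC => (div_le_iff₀ hD).2 (hC.2 x x')

/-- A function that is at least `N` and `N`-Hölder satisfies the exponential cone inequality. -/
theorem le_exp_mul_of_abs_sub_le {X : Type*} [PseudoMetricSpace X] {α a N : ℝ} (ha : 1 ≤ a)
    {g : X → ℝ} (hN : 0 ≤ N) (hg : ∀ x, N ≤ g x)
    (hv : ∀ x x', |g x - g x'| ≤ N * dist x x' ^ α) (x x' : X) :
    g x ≤ Real.exp (a * dist x x' ^ α) * g x' := by
  have hD : 0 ≤ dist x x' ^ α := Real.rpow_nonneg dist_nonneg α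
  have hexp : dist x x' ^ α + 1 ≤ Real.exp (a * dist x x' ^ α) :=
    (Real.add_one_le_exp _).trans (Real.exp_le_exp.2 (le_mul_of_one_le_left hD ha))
  calc g x ≤ g x' + N * dist x x' ^ α := by linarith [le_of_abs_le (hv x x')]
    _ ≤ (dist x x' ^ α + 1) * g x' := by
      linarith [mul_le_mul_of_nonneg_right (hg x') hD]
    _ ≤ Real.exp (a * dist x x' ^ α) * g x' :=
      mul_le_mul_of_nonneg_right hexp (hN.trans (hg x'))

/-- bounded aperture of the dual of the exponential Birkhoff cone
`𝒞 = {g ≥ 0 : g(x) ≤ e^{a·d(x,x')^α} g(x')}`. -/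
theorem stmt_10 {X : Type*} [MetricSpace X] [Nonempty X]
    (α : ℝ) (hα : α ∈ Set.Ioc (0 : ℝ) 1) (a : ℝ) (ha : 1 ≤ a)
    (μ : (X →ᵇ ℝ) →ₗ[ℝ] ℝ)
    (hμ : ∀ g : X →ᵇ ℝ, (∀ x, 0 ≤ g x) →
      (∀ x x', g x ≤ Real.exp (a * dist x x' ^ α) * g x') → 0 ≤ μ g)
    (h : X →ᵇ ℝ)
    (hh : ∃ C : ℝ, 0 ≤ C ∧ ∀ x x', |h x - h x'| ≤ C * dist x x' ^ α) :
    |μ h| ≤ 2 * (‖h‖ + vHolder α (fun x => h x)) * μ 1 := by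
  set N := ‖h‖ + vHolder α (fun x => h x) with hN
  have hv0 := vHolder_nonneg α (fun x => h x)
  have hN0 : 0 ≤ N := add_nonneg (norm_nonneg h) hv0
  have hb (x : X) : |h x| ≤ N := by
    have := h.norm_coe_le_norm x
    rw [Real.norm_eq_abs] at this
    linarith
  have hv (x x' : X) : |h x - h x'| ≤ N * dist x x' ^ α :=
    (abs_sub_le_vHolder_mul hh x x').trans
      (mul_le_mul_of_nonneg_right (by linarith [norm_nonneg h])
        (Real.rpow_nonneg dist_nonneg α))
  have key (g : X →ᵇ ℝ) (hg : ∀ x, N ≤ g x)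
      (hgv : ∀ x x', |g x - g x'| ≤ N * dist x x' ^ α) : 0 ≤ μ g :=
    hμ g (fun x => hN0.trans (hg x)) (le_exp_mul_of_abs_sub_le ha hN0 hg hgv)
  have hplus : 0 ≤ μ ((2 * N) • 1 + h) := by
    refine key _ (fun x => ?_) fun x x' => ?_
    · simp only [BoundedContinuousFunction.coe_add, BoundedContinuousFunction.coe_smul,
        BoundedContinuousFunction.coe_one, Pi.add_apply, Pi.one_apply, smul_eq_mul]
      linarith [neg_le_of_abs_le (hb x)]
    · simpa using hv x x'
  have hminus : 0 ≤ μ ((2 * N) • 1 - h) := by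
    refine key _ (fun x => ?_) fun x x' => ?_
    · simp only [BoundedContinuousFunction.coe_sub, BoundedContinuousFunction.coe_smul,
        BoundedContinuousFunction.coe_one, Pi.sub_apply, Pi.one_apply, smul_eq_mul]
      linarith [le_of_abs_le (hb x)]
    · simpa [abs_sub_comm] using hv x x'
  rw [map_add, map_smul, smul_eq_mul] at hplus
  rw [map_sub, map_smul, smul_eq_mul] at hminus
  exact abs_le.2 ⟨by linarith, by linarith⟩
end

section
/- Let (X,d) and (X',d') be metric spaces, α ∈ (0,1], γ > 0, H ≥ 0, and let (y_i)_{i∈ι} be a countable family of maps y_i : X' → X satisfying d(y_i(x), y_i(x')) ≤ γ^{−1}·d'(x,x') for all i and all x,x' ∈ X'. Let φ : X → ℝ satisfy |φ(y_i(x)) − φ(y_i(x'))| ≤ H·d'(x,x')^α for all i and all x,x' ∈ X'. Let g : X → [0,∞) satisfy g(u) ≤ exp(γ^α·d(u,u')^α)·g(u') for all u,u' ∈ X, and assume that for every x ∈ X' the family (e^{φ(y_i(x))}·g(y_i(x)))_{i∈ι} is summable, with sum ℒg(x) := ∑_{i∈ι} e^{φ(y_i(x))}·g(y_i(x)). Then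 for all x,x' ∈ X': ℒg(x) ≤ exp((H+1)·d'(x,x')^α)·ℒg(x'). In particular, if H ≤ (γ')^α − 1 for some γ' > 0, then ℒg(u) ≤ exp((γ')^α·d'(u,u')^α)·ℒg(u') for all u,u' ∈ X'. -/
/-- Scaling by `γ ^ α` undoes a contraction by `γ⁻¹` of the `α`-th power of a length. -/
theorem Real.rpow_mul_rpow_le_of_le_inv_mul {α γ s t : ℝ} (hα : 0 ≤ α) (hγ : 0 < γ) (hs : 0 ≤ s)
    (h : s ≤ γ⁻¹ * t) : γ ^ α * s ^ α ≤ t ^ α := by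
  rw [← Real.mul_rpow hγ.le hs]
  exact Real.rpow_le_rpow (by positivity) ((le_inv_mul_iff₀ hγ).1 h) hα

/-- cone invariance for the transfer operator
`ℒg(x) = ∑_i e^{φ(y_i(x))} g(y_i(x))` of a properly expanding map:
`ℒ` maps the exponential cone with parameter `γ^α` into the one with parameter `H+1`. -/
theorem stmt_12 {X X' ι : Type*} [MetricSpace X] [MetricSpace X'] [Countable ι]
    (α : ℝ) (hα : α ∈ Set.Ioc (0 : ℝ) 1) (γ : ℝ) (hγ : 0 < γ) (H : ℝ) (hH : 0 ≤ H)
    (y : ι → X' → X)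
    (hy : ∀ (i : ι) (x x' : X'), dist (y i x) (y i x') ≤ γ⁻¹ * dist x x')
    (φ : X → ℝ)
    (hφ : ∀ (i : ι) (x x' : X'), |φ (y i x) - φ (y i x')| ≤ H * dist x x' ^ α)
    (g : X → ℝ) (hg0 : ∀ u, 0 ≤ g u)
    (hg : ∀ u u' : X, g u ≤ Real.exp (γ ^ α * dist u u' ^ α) * g u')
    (hsum : ∀ x : X', Summable fun i => Real.exp (φ (y i x)) * g (y i x)) :
    (∀ x x' : X',
      (∑' i, Real.exp (φ (y i x)) * g (y i x)) ≤
        Real.exp ((H + 1) * dist x x' ^ α) * ∑' i, Real.exp (φ (y i x')) * g (y i x')) ∧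
      ∀ γ' : ℝ, 0 < γ' → H ≤ γ' ^ α - 1 →
        ∀ u u' : X',
          (∑' i, Real.exp (φ (y i u)) * g (y i u)) ≤
            Real.exp (γ' ^ α * dist u u' ^ α) * ∑' i, Real.exp (φ (y i u')) * g (y i u') := by
  have main : ∀ x x' : X',
      (∑' i, Real.exp (φ (y i x)) * g (y i x)) ≤
        Real.exp ((H + 1) * dist x x' ^ α) * ∑' i, Real.exp (φ (y i x')) * g (y i x') := by
    intro x x'
    rw [← tsum_mul_left]
    refine (hsum x).tsum_le_tsum (fun i => ?_) ((hsum x').mul_left _)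
    have hφi : φ (y i x) ≤ H * dist x x' ^ α + φ (y i x') :=
      sub_le_iff_le_add.1 ((le_abs_self _).trans (hφ i x x'))
    have hdist := Real.rpow_mul_rpow_le_of_le_inv_mul hα.1.le hγ dist_nonneg (hy i x x')
    have hgi : g (y i x) ≤ Real.exp (dist x x' ^ α) * g (y i x') :=
      (hg _ _).trans (mul_le_mul_of_nonneg_right (Real.exp_le_exp.2 hdist) (hg0 _))
    calc Real.exp (φ (y i x)) * g (y i x)
        ≤ Real.exp (H * dist x x' ^ α + φ (y i x')) *
            (Real.exp (dist x x' ^ α) * g (y i x')) :=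
          mul_le_mul (Real.exp_le_exp.2 hφi) hgi (hg0 _) (Real.exp_pos _).le
      _ = Real.exp ((H + 1) * dist x x' ^ α) * (Real.exp (φ (y i x')) * g (y i x')) := by
          rw [add_one_mul, Real.exp_add, Real.exp_add]
          ring
  refine ⟨main, fun γ' _ hH' u u' => (main u u').trans ?_⟩
  refine mul_le_mul_of_nonneg_right (Real.exp_le_exp.2 ?_)
    (tsum_nonneg fun i => mul_nonneg (Real.exp_pos _).le (hg0 _))
  exact mul_le_mul_of_nonneg_right (le_sub_iff_add_le.1 hH') (Real.rpow_nonneg dist_nonneg _)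
end

section
/- Let (X,d) be a metric space with diameter at most 1, (X',d') a metric space, α ∈ (0,1], integers 1 ≤ q < N, and constants l > 0, σ > 1, κ > 0, H ≥ 0. Let y₁,…,y_N : X' → X satisfy d(y_i(x), y_i(x')) ≤ l·d'(x,x') for 1 ≤ i ≤ q and d(y_i(x), y_i(x')) ≤ σ^{−1}·d'(x,x') for q < i ≤ N, for all x,x' ∈ X'. Let φ : X → ℝ be bounded with oscillation ε := sup_X φ − inf_X φ and with |φ(y_i(x)) − φ(y_i(x'))| ≤ H·d'(x,x')^α for all i and x,x' ∈ X'. Let g : X → ℝ satisfy inf_X g > 0 and v_α(g) ≤ κ·inf_X g, and define ℒg(x) = ∑_{i=1}^{N} e^{φ(y_i(x))}·g(y_i(x)). Then inf_{X'} ℒg ≥ N·e^{inf φ}·inf_X g > 0 and v_α(ℒg) ≤ (s·κ + (1+κ)·e^{ε}·H)·inf_{X'} ℒg, where s := e^{ε}·(q·l^α + (N−q)·σ^{−α})/N. -/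
theorem Real.abs_exp_sub_exp_le {s t b : ℝ} (hs : s ≤ b) (ht : t ≤ b) :
    |Real.exp s - Real.exp t| ≤ Real.exp b * |s - t| := by
  wlog h : t ≤ s generalizing s t
  · rw [abs_sub_comm, abs_sub_comm s t]
    exact this ht hs (le_of_not_ge h)
  rw [abs_of_nonneg (sub_nonneg.2 (Real.exp_le_exp.2 h)), abs_of_nonneg (sub_nonneg.2 h)]
  have h1 : Real.exp t = Real.exp s * Real.exp (t - s) := by
    rw [← Real.exp_add]; ring_nf
  have h2 := Real.add_one_le_exp (t - s)
  calc Real.exp s - Real.exp t = Real.exp s * (1 - Real.exp (t - s)) := by rw [h1]; ring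
    _ ≤ Real.exp s * (s - t) :=
      mul_le_mul_of_nonneg_left (by linarith) (Real.exp_pos s).le
    _ ≤ Real.exp b * (s - t) := by
      have := sub_nonneg.2 h
      gcongr

theorem Fin.sum_ite_val_lt {q N : ℕ} (hqN : q ≤ N) (a b : ℝ) :
    ∑ i : Fin N, (if (i : ℕ) < q then a else b) = (q : ℝ) * a + ((N : ℝ) - (q : ℝ)) * b := by
  obtain ⟨k, rfl⟩ := Nat.exists_eq_add_of_le hqN
  rw [Fin.sum_univ_add]
  simp


/-- cone invariance for the transfer operator of a partially
expanding map: lower bound on `inf ℒg` and Hölder-variation bound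
`v_α(ℒg) ≤ (s·κ + (1+κ)e^ε H) · inf ℒg` with
`s = e^ε (q l^α + (N−q) σ^{−α})/N`. -/
theorem stmt_13 {X X' : Type*} [MetricSpace X] [MetricSpace X'] [Nonempty X] [Nonempty X']
    (hdiam : ∀ u u' : X, dist u u' ≤ 1)
    (α : ℝ) (hα : α ∈ Set.Ioc (0 : ℝ) 1)
    (q N : ℕ) (hq : 1 ≤ q) (hqN : q < N)
    (l σ κ H : ℝ) (hl : 0 < l) (hσ : 1 < σ) (hκ : 0 < κ) (hH : 0 ≤ H)
    (y : Fin N → X' → X)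
    (hyexp : ∀ i : Fin N, (i : ℕ) < q →
      ∀ x x' : X', dist (y i x) (y i x') ≤ l * dist x x')
    (hycon : ∀ i : Fin N, q ≤ (i : ℕ) →
      ∀ x x' : X', dist (y i x) (y i x') ≤ σ⁻¹ * dist x x')
    (φ : X → ℝ) (hφa : BddAbove (Set.range φ)) (hφb : BddBelow (Set.range φ))
    (hφH : ∀ (i : Fin N) (x x' : X'), |φ (y i x) - φ (y i x')| ≤ H * dist x x' ^ α)
    (g : X → ℝ) (hginf : 0 < ⨅ u, g u)
    (hgH : ∀ u u' : X, |g u - g u'| ≤ (κ * ⨅ v, g v) * dist u u' ^ α) :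
    (0 < (N : ℝ) * Real.exp (⨅ u, φ u) * ⨅ u, g u) ∧
      ((N : ℝ) * Real.exp (⨅ u, φ u) * (⨅ u, g u) ≤
        ⨅ x' : X', ∑ i : Fin N, Real.exp (φ (y i x')) * g (y i x')) ∧
      ∀ x x' : X',
        |(∑ i : Fin N, Real.exp (φ (y i x)) * g (y i x)) -
            ∑ i : Fin N, Real.exp (φ (y i x')) * g (y i x')| ≤
          ((Real.exp ((⨆ u, φ u) - ⨅ u, φ u) *
                ((q : ℝ) * l ^ α + ((N : ℝ) - (q : ℝ)) * σ ^ (-α)) / (N : ℝ)) * κ +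
              (1 + κ) * Real.exp ((⨆ u, φ u) - ⨅ u, φ u) * H) *
            (⨅ x'' : X', ∑ i : Fin N, Real.exp (φ (y i x'')) * g (y i x'')) *
            dist x x' ^ α := by
  obtain ⟨hα0, -⟩ := hα
  have hgb : BddBelow (Set.range g) := by
    by_contra h
    rw [Real.iInf_of_not_bddBelow h] at hginf
    exact lt_irrefl _ hginf
  set m := ⨅ u, g u with hm
  set a := ⨅ u, φ u with ha
  set b := ⨆ u, φ u with hb
  have hmg : ∀ u, m ≤ g u := fun u => ciInf_le hgb u
  have haφ : ∀ u, a ≤ φ u := fun u => ciInf_le hφb u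
  have hφb' : ∀ u, φ u ≤ b := fun u => le_ciSup hφa u
  have hN : (0 : ℝ) < N := by exact_mod_cast (by omega : 0 < N)
  have hκm : 0 ≤ κ * m := by positivity
  have hgup : ∀ u, g u ≤ (1 + κ) * m := by
    intro u
    have h : g u - κ * m ≤ m := le_ciInf fun u' => by
      have h1 := (le_abs_self _).trans (hgH u u')
      have h2 : dist u u' ^ α ≤ 1 := Real.rpow_le_one dist_nonneg (hdiam u u') hα0.le
      have h3 := mul_le_mul_of_nonneg_left h2 hκm
      linarith
    linarith
  have hlow : ∀ x' : X', (N : ℝ) * Real.exp a * m ≤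
      ∑ i : Fin N, Real.exp (φ (y i x')) * g (y i x') := by
    intro x'
    calc (N : ℝ) * Real.exp a * m = ∑ _i : Fin N, Real.exp a * m := by
          simp [mul_assoc]
      _ ≤ _ := Finset.sum_le_sum fun i _ =>
          mul_le_mul (Real.exp_le_exp.2 (haφ _)) (hmg _) hginf.le (Real.exp_pos _).le
  have hI := le_ciInf hlow
  refine ⟨by positivity, hI, fun x x' => ?_⟩
  have hD : 0 ≤ dist x x' ^ α := Real.rpow_nonneg dist_nonneg _
  have hdist : ∀ i : Fin N, dist (y i x) (y i x') ^ α ≤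
      (if (i : ℕ) < q then l ^ α else σ ^ (-α)) * dist x x' ^ α := by
    intro i
    have hσ0 : 0 ≤ σ := by linarith
    split_ifs with hi
    · rw [← Real.mul_rpow hl.le dist_nonneg]
      exact Real.rpow_le_rpow dist_nonneg (hyexp i hi x x') hα0.le
    · rw [Real.rpow_neg hσ0, ← Real.inv_rpow hσ0,
        ← Real.mul_rpow (inv_nonneg.2 hσ0) dist_nonneg]
      exact Real.rpow_le_rpow dist_nonneg (hycon i (not_lt.1 hi) x x') hα0.le
  have hterm : ∀ i : Fin N,
      |Real.exp (φ (y i x)) * g (y i x) - Real.exp (φ (y i x')) * g (y i x')| ≤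
        Real.exp b * (κ * m) * dist x x' ^ α * (if (i : ℕ) < q then l ^ α else σ ^ (-α)) +
          (1 + κ) * m * Real.exp b * H * dist x x' ^ α := by
    intro i
    have hg0 : 0 ≤ g (y i x') := hginf.le.trans (hmg _)
    have h1 : Real.exp (φ (y i x)) * |g (y i x) - g (y i x')| ≤ Real.exp b *
        ((κ * m) * ((if (i : ℕ) < q then l ^ α else σ ^ (-α)) * dist x x' ^ α)) :=
      mul_le_mul (Real.exp_le_exp.2 (hφb' _))
        ((hgH _ _).trans (mul_le_mul_of_nonneg_left (hdist i) hκm))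
        (abs_nonneg _) (Real.exp_pos _).le
    have h2 : g (y i x') * |Real.exp (φ (y i x)) - Real.exp (φ (y i x'))| ≤
        ((1 + κ) * m) * (Real.exp b * (H * dist x x' ^ α)) :=
      mul_le_mul (hgup _)
        ((Real.abs_exp_sub_exp_le (hφb' _) (hφb' _)).trans
          (mul_le_mul_of_nonneg_left (hφH i x x') (Real.exp_pos _).le))
        (abs_nonneg _) (by positivity)
    have h3 : Real.exp (φ (y i x)) * g (y i x) - Real.exp (φ (y i x')) * g (y i x') =
        Real.exp (φ (y i x)) * (g (y i x) - g (y i x')) +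
          g (y i x') * (Real.exp (φ (y i x)) - Real.exp (φ (y i x'))) := by ring
    rw [h3]
    refine (abs_add_le _ _).trans ?_
    rw [abs_mul, abs_mul, abs_of_pos (Real.exp_pos _), abs_of_nonneg hg0]
    linarith
  have hqN' : (0 : ℝ) ≤ (N : ℝ) - q := sub_nonneg.2 (by exact_mod_cast hqN.le)
  have hC : 0 ≤ Real.exp (b - a) *
      ((q : ℝ) * l ^ α + ((N : ℝ) - (q : ℝ)) * σ ^ (-α)) / (N : ℝ) * κ +
      (1 + κ) * Real.exp (b - a) * H := by positivity
  have hexp : Real.exp b = Real.exp (b - a) * Real.exp a := by rw [← Real.exp_add]; ring_nf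
  rw [← Finset.sum_sub_distrib]
  calc _ ≤ ∑ i : Fin N, (Real.exp b * (κ * m) * dist x x' ^ α *
            (if (i : ℕ) < q then l ^ α else σ ^ (-α)) +
          (1 + κ) * m * Real.exp b * H * dist x x' ^ α) :=
        (Finset.abs_sum_le_sum_abs _ _).trans (Finset.sum_le_sum fun i _ => hterm i)
    _ = (Real.exp (b - a) *
          ((q : ℝ) * l ^ α + ((N : ℝ) - (q : ℝ)) * σ ^ (-α)) / (N : ℝ) * κ +
          (1 + κ) * Real.exp (b - a) * H) * ((N : ℝ) * Real.exp a * m) * dist x x' ^ α := by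
        rw [Finset.sum_add_distrib, ← Finset.mul_sum, Fin.sum_ite_val_lt hqN.le, hexp]
        simp only [Finset.sum_const, Finset.card_univ, Fintype.card_fin, nsmul_eq_mul]
        field_simp
    _ ≤ _ := mul_le_mul_of_nonneg_right (mul_le_mul_of_nonneg_left hI hC) hD
end

section
/- Let (X,d) be a metric space with diameter at most 1, α ∈ (0,1], and a > 0. Let g : X → [0,∞) satisfy g(x) ≤ exp(a·d(x,x')^α)·g(x') for all x,x' ∈ X. Then sup_X g ≤ e^{a}·inf_X g, the α-Hölder seminorm satisfies v_α(g) ≤ a·sup_X g, and consequently sup_X g + v_α(g) ≤ (1+a)·e^{a}·inf_X g. In particular, for any probability measure ν on X (with g Borel measurable), sup_X g + v_α(g) ≤ (1+a)·e^{a}·∫ g dν. -/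
open MeasureTheory

/-- If `0 ≤ u ≤ exp t * v`, then `u - v ≤ t * u`. -/
theorem sub_le_mul_of_le_exp_mul {t u v : ℝ} (hu : 0 ≤ u) (h : u ≤ Real.exp t * v) :
    u - v ≤ t * u := by
  have hv : Real.exp (-t) * u ≤ v := by
    rwa [Real.exp_neg, inv_mul_le_iff₀ (Real.exp_pos t)]
  have h1 := mul_le_mul_of_nonneg_right (Real.one_sub_le_exp_neg t) hu
  linarith

/-- bounded aperture of the exponential Birkhoff cone on a space
of diameter at most one: `sup g ≤ e^a inf g`, `v_α(g) ≤ a·sup g`, and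
`‖g‖_α ≤ (1+a)e^a inf g ≤ (1+a)e^a ∫ g dν` for any probability measure `ν`. -/
theorem stmt_14 {X : Type*} [MetricSpace X] [MeasurableSpace X] [BorelSpace X] [Nonempty X]
    (hdiam : ∀ x x' : X, dist x x' ≤ 1)
    (α : ℝ) (hα : α ∈ Set.Ioc (0 : ℝ) 1) (a : ℝ) (ha : 0 < a)
    (g : X → ℝ) (hg0 : ∀ x, 0 ≤ g x)
    (hg : ∀ x x' : X, g x ≤ Real.exp (a * dist x x' ^ α) * g x') :
    (⨆ x, g x) ≤ Real.exp a * ⨅ x, g x ∧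
      vHolder α g ≤ a * ⨆ x, g x ∧
      (⨆ x, g x) + vHolder α g ≤ (1 + a) * Real.exp a * ⨅ x, g x ∧
      ∀ ν : Measure X, IsProbabilityMeasure ν → Measurable g →
        (⨆ x, g x) + vHolder α g ≤ (1 + a) * Real.exp a * ∫ x, g x ∂ν := by
  have hle : ∀ x x', g x ≤ Real.exp a * g x' := fun x x' =>
    (hg x x').trans <| mul_le_mul_of_nonneg_right (Real.exp_le_exp.2 <|
      mul_le_of_le_one_right ha.le <|
        Real.rpow_le_one dist_nonneg (hdiam x x') hα.1.le) (hg0 x')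
  have hbdd : BddAbove (Set.range g) := by
    obtain ⟨y⟩ := ‹Nonempty X›
    exact ⟨Real.exp a * g y, by rintro _ ⟨x, rfl⟩; exact hle x y⟩
  have hbddBelow : BddBelow (Set.range g) := ⟨0, by rintro _ ⟨x, rfl⟩; exact hg0 x⟩
  have hsup : (⨆ x, g x) ≤ Real.exp a * ⨅ x, g x := by
    rw [Real.mul_iInf_of_nonneg (Real.exp_pos a).le]
    exact ciSup_le fun x => le_ciInf fun x' => hle x x'
  have hsub : ∀ x x', g x - g x' ≤ a * (⨆ x, g x) * dist x x' ^ α := fun x x' => by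
    have ht : 0 ≤ a * dist x x' ^ α := by positivity
    have h := sub_le_mul_of_le_exp_mul (hg0 x) (hg x x')
    have h' := mul_le_mul_of_nonneg_left (le_ciSup hbdd x) ht
    linarith
  have hv : vHolder α g ≤ a * ⨆ x, g x := by
    refine csInf_le ⟨0, fun C hC => hC.1⟩ ⟨mul_nonneg ha.le (Real.iSup_nonneg hg0), ?_⟩
    refine fun x x' => abs_sub_le_iff.2 ⟨hsub x x', ?_⟩
    simpa only [dist_comm] using hsub x' x
  have hnorm : (⨆ x, g x) + vHolder α g ≤ (1 + a) * Real.exp a * ⨅ x, g x := by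
    have h := mul_le_mul_of_nonneg_left hsup (by positivity : 0 ≤ 1 + a)
    linarith
  refine ⟨hsup, hv, hnorm, fun ν _ hmeas => hnorm.trans ?_⟩
  have hint : Integrable g ν :=
    .of_bound hmeas.aestronglyMeasurable (⨆ x, g x) <| .of_forall fun x => by
      rw [Real.norm_of_nonneg (hg0 x)]
      exact le_ciSup hbdd x
  refine mul_le_mul_of_nonneg_left ?_ (by positivity)
  simpa using integral_mono (μ := ν) (integrable_const (⨅ x, g x)) hint
    fun x => ciInf_le hbddBelow x
end
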